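/- Let Φ₁ be an increasing homeomorphism of [0,∞); let Φ₂ be a convex increasing homeomorphism of [0,∞) with Φ₂(t)/t → 0 as t → 0⁺ and Φ₂(t)/t → ∞ as t → ∞, and let Ψ₂ be its complementary function. For i = 1,2 set ρ_i(t) = 1/(t·Φ_i⁻¹(1/t)) for t > 0. If Φ is an increasing homeomorphism of [0,∞) satisfying 1/(t·Φ⁻¹(1/t)) = ρ₁(t)/ρ₂(t) for all t > 0, then for every t > 0 one has (1/2)·Φ₁⁻¹(t)·Ψ₂⁻¹(t) ≤ Φ⁻¹(t) ≤ Φ₁⁻¹(t)·Ψ₂⁻¹(t). -/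

import Mathlib

/-- A convex function on `[0,∞)` vanishing at `0` has increasing slopes through the origin. -/
theorem ConvexOn.mul_le_mul_of_map_zero {f : ℝ → ℝ} (hf : ConvexOn ℝ (Set.Ici 0) f)
    (h0 : f 0 = 0) {a u : ℝ} (ha : 0 < a) (hau : a ≤ u) : u * f a ≤ a * f u := by
  have hu : 0 < u := ha.trans_le hau
  have h := hf.2 (Set.mem_Ici.2 le_rfl) (Set.mem_Ici.2 hu.le)
    (sub_nonneg.2 ((div_le_one hu).2 hau)) (div_pos ha hu).le (by ring)
  simp only [smul_eq_mul, mul_zero, zero_add, h0, div_mul_cancel₀ a hu.ne'] at h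
  rw [div_mul_eq_mul_div, le_div_iff₀ hu] at h
  linarith

/-- **Young's inequality**, at a point where the complementary function is nonzero
(so that the supremum defining it is finite). -/
theorem mul_le_add_of_sSup_eq {f : ℝ → ℝ} {a b t : ℝ} (ha : 0 ≤ a) (ht : t ≠ 0)
    (hb : sSup ((fun u => u * b - f u) '' Set.Ici 0) = t) : a * b ≤ f a + t := by
  have hbdd : BddAbove ((fun u => u * b - f u) '' Set.Ici 0) := by
    by_contra h
    exact ht (hb.symm.trans (Real.sSup_of_not_bddAbove h))
  have h := le_csSup hbdd (Set.mem_image_of_mem (fun u => u * b - f u) (Set.mem_Ici.2 ha))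
  rw [hb] at h
  linarith

/-- If a nonnegative convex `f` vanishing at `0` takes at `a` the value that its complementary
function takes at `b`, then this common value is at most `a * b`. -/
theorem ConvexOn.le_mul_of_sSup_eq {f : ℝ → ℝ} (hf : ConvexOn ℝ (Set.Ici 0) f)
    (h0 : f 0 = 0) (hnn : ∀ u, 0 ≤ u → 0 ≤ f u) {a b : ℝ} (ha : 0 < a) (hb0 : 0 ≤ b)
    (hb : sSup ((fun u => u * b - f u) '' Set.Ici 0) = f a) : f a ≤ a * b := by
  by_contra! hlt
  refine hlt.not_ge (hb.symm.trans_le (csSup_le (Set.nonempty_Ici.image _) ?_))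
  rintro _ ⟨u, hu, rfl⟩
  have hu0 : 0 ≤ u := hu
  rcases le_total u a with hua | hau
  · have h₁ := mul_le_mul_of_nonneg_right hua hb0
    have h₂ := hnn u hu0
    change u * b - f u ≤ a * b
    linarith
  · have h₁ := hf.mul_le_mul_of_map_zero h0 ha hau
    have h₂ := mul_le_mul_of_nonneg_left hlt.le hu0
    have h₃ : u * b - f u ≤ 0 := by
      refine nonpos_of_mul_nonpos_right ?_ ha
      linarith
    exact h₃.trans (mul_nonneg ha.le hb0)

/-- An inverse on `[0,∞)` of a function vanishing at `0` is positive at positive points. -/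
theorem pos_of_rightInverse_on_nonneg {f g : ℝ → ℝ} (h0 : f 0 = 0)
    (hg : ∀ t, 0 ≤ t → 0 ≤ g t) (hfg : ∀ t, 0 ≤ t → f (g t) = t) {t : ℝ} (ht : 0 < t) :
    0 < g t := by
  refine (hg t ht.le).lt_of_ne fun h => ht.ne ?_
  rw [← hfg t ht.le, ← h, h0]

/-- Lemma 2.3: if `ρ_Φ = ρ₁/ρ₂` (with `ρ_i(t) = 1/(t·Φ_i⁻¹(1/t))`), then
`Φ⁻¹(t) ≃ Φ₁⁻¹(t)·Ψ₂⁻¹(t)` with constants `1/2` and `1`, where `Ψ₂` is the complementary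
function of the convex function `Φ₂`. -/
theorem stmt_3 (Φ₁ Φ₁inv : ℝ → ℝ)
    (h₁mono : StrictMonoOn Φ₁ (Set.Ici 0))
    (h₁cont : ContinuousOn Φ₁ (Set.Ici 0))
    (h₁zero : Φ₁ 0 = 0)
    (h₁inv_nonneg : ∀ t, 0 ≤ t → 0 ≤ Φ₁inv t)
    (h₁left : ∀ t, 0 ≤ t → Φ₁inv (Φ₁ t) = t)
    (h₁right : ∀ t, 0 ≤ t → Φ₁ (Φ₁inv t) = t)
    (Φ₂ Φ₂inv : ℝ → ℝ)
    (h₂mono : StrictMonoOn Φ₂ (Set.Ici 0))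
    (h₂cont : ContinuousOn Φ₂ (Set.Ici 0))
    (h₂zero : Φ₂ 0 = 0)
    (h₂conv : ConvexOn ℝ (Set.Ici 0) Φ₂)
    (h₂inv_nonneg : ∀ t, 0 ≤ t → 0 ≤ Φ₂inv t)
    (h₂left : ∀ t, 0 ≤ t → Φ₂inv (Φ₂ t) = t)
    (h₂right : ∀ t, 0 ≤ t → Φ₂ (Φ₂inv t) = t)
    (h₂lim0 : Filter.Tendsto (fun t => Φ₂ t / t) (nhdsWithin 0 (Set.Ioi 0)) (nhds 0))
    (h₂limtop : Filter.Tendsto (fun t => Φ₂ t / t) Filter.atTop Filter.atTop)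
    -- `Ψ₂` is the complementary function of `Φ₂`, with inverse `Ψ₂inv` on `[0,∞)` :
    (Ψ₂ Ψ₂inv : ℝ → ℝ)
    (hΨ₂ : ∀ s, Ψ₂ s = sSup ((fun t => t * s - Φ₂ t) '' Set.Ici 0))
    (hΨ₂inv_nonneg : ∀ t, 0 ≤ t → 0 ≤ Ψ₂inv t)
    (hΨ₂left : ∀ t, 0 ≤ t → Ψ₂inv (Ψ₂ t) = t)
    (hΨ₂right : ∀ t, 0 ≤ t → Ψ₂ (Ψ₂inv t) = t)
    (Φ Φinv : ℝ → ℝ)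
    (hmono : StrictMonoOn Φ (Set.Ici 0))
    (hcont : ContinuousOn Φ (Set.Ici 0))
    (hzero : Φ 0 = 0)
    (hinv_nonneg : ∀ t, 0 ≤ t → 0 ≤ Φinv t)
    (hleft : ∀ t, 0 ≤ t → Φinv (Φ t) = t)
    (hright : ∀ t, 0 ≤ t → Φ (Φinv t) = t)
    -- `ρ_Φ = ρ₁ / ρ₂` :
    (hrho : ∀ t : ℝ, 0 < t →
      1 / (t * Φinv (1 / t)) = (1 / (t * Φ₁inv (1 / t))) / (1 / (t * Φ₂inv (1 / t)))) :
    ∀ t : ℝ, 0 < t →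
      (1 / 2) * (Φ₁inv t * Ψ₂inv t) ≤ Φinv t ∧ Φinv t ≤ Φ₁inv t * Ψ₂inv t := by
  intro t ht
  have ha := pos_of_rightInverse_on_nonneg h₂zero h₂inv_nonneg h₂right ht
  have hp := pos_of_rightInverse_on_nonneg h₁zero h₁inv_nonneg h₁right ht
  have hq := pos_of_rightInverse_on_nonneg hzero hinv_nonneg hright ht
  have hΦ₂a := h₂right t ht.le
  have hb : sSup ((fun u => u * Ψ₂inv t - Φ₂ u) '' Set.Ici 0) = t :=
    (hΨ₂ _).symm.trans (hΨ₂right t ht.le)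
  have hupper := mul_le_add_of_sSup_eq ha.le ht.ne' hb
  have hnn : ∀ u, 0 ≤ u → 0 ≤ Φ₂ u := fun u hu =>
    h₂zero.symm.trans_le (h₂mono.monotoneOn (Set.mem_Ici.2 le_rfl) hu hu)
  have hlower := h₂conv.le_mul_of_sSup_eq h₂zero hnn ha (hΨ₂inv_nonneg t ht.le)
    (hb.trans hΦ₂a.symm)
  rw [hΦ₂a] at hupper hlower
  have hprod : Φinv t * Φ₂inv t = Φ₁inv t * t := by
    have h := hrho (1 / t) (one_div_pos.2 ht)
    rw [one_div_one_div] at h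
    field_simp at h
    linarith
  constructor
  · refine le_of_mul_le_mul_right ?_ ha
    linarith [mul_le_mul_of_nonneg_left hupper hp.le]
  · refine le_of_mul_le_mul_right ?_ ha
    linarith [mul_le_mul_of_nonneg_left hlower hp.le]
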